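/- arXiv:0711.2356 — 3 statements merged into one kernel-verified Lean document; each statement's English description precedes it below -/
import Mathlib

section
/- (Uniqueness for the self-consistent system.) Suppose (f_+, f_−) and (g_+, g_−) are two pairs of functions, each analytic on ℂ∖ℝ with Im f_α(z)·Im z > 0 and Im g_α(z)·Im z > 0 for Im z ≠ 0, and each satisfying f_α(z) = ∫ ν₀(dE)/(E + αs − z − v² f_{−α}(z)) for α = ± and all Im z ≠ 0. Then f_α = g_α for α = ±. -/
open MeasureTheory

noncomputable section

/-- The sign `±1` attached to the index `α ∈ {+,−}` (`0 ↦ +1`, `1 ↦ −1`). -/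
def sgn (a : Fin 2) : ℝ := if a = 0 then 1 else -1

/-- The opposite index: `−α`. -/
def oppo (a : Fin 2) : Fin 2 := if a = 0 then 1 else 0

/-- `(f +, f −)` is a solution of the self-consistent system
`f_α(z) = ∫ ν₀(dE)/(E + αs − z − v² f_{−α}(z))` in the class of pairs of functions
analytic on `ℂ∖ℝ` with `Im f_α(z) · Im z > 0` for `Im z ≠ 0`. -/
def IsSCSolution (ν0 : Measure ℝ) (s v : ℝ) (f : Fin 2 → ℂ → ℂ) : Prop :=
  (∀ a, DifferentiableOn ℂ (f a) {z : ℂ | z.im ≠ 0}) ∧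
  (∀ a, ∀ z : ℂ, z.im ≠ 0 → 0 < (f a z).im * z.im) ∧
  (∀ a, ∀ z : ℂ, z.im ≠ 0 →
    f a z = ∫ E, (((E : ℂ) + (sgn a * s : ℝ)) - z - (v : ℂ) ^ 2 * f (oppo a) z)⁻¹ ∂ν0)

/-- The second absolute moment `∫ |E - w|⁻² dν(E)` of the resolvent kernel. -/
def resolventSq (ν : Measure ℝ) (w : ℂ) : ℝ := ∫ E : ℝ, ‖((E : ℂ) - w)⁻¹‖ ^ 2 ∂ν

lemma resolventSq_nonneg (ν : Measure ℝ) (w : ℂ) : 0 ≤ resolventSq ν w :=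
  integral_nonneg fun _ => by positivity

lemma ofReal_sub_ne_zero {w : ℂ} (hw : w.im ≠ 0) (E : ℝ) : (E : ℂ) - w ≠ 0 := by
  intro h
  apply hw
  simpa using congrArg Complex.im h

lemma continuous_inv_ofReal_sub {w : ℂ} (hw : w.im ≠ 0) :
    Continuous fun E : ℝ => ((E : ℂ) - w)⁻¹ :=
  Continuous.inv₀ (by fun_prop) (ofReal_sub_ne_zero hw)

lemma norm_inv_ofReal_sub_le {w : ℂ} (hw : w.im ≠ 0) (E : ℝ) :
    ‖((E : ℂ) - w)⁻¹‖ ≤ |w.im|⁻¹ := by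
  rw [norm_inv]
  have h : |w.im| ≤ ‖(E : ℂ) - w‖ := by
    simpa using Complex.abs_im_le_norm ((E : ℂ) - w)
  exact inv_anti₀ (abs_pos.mpr hw) h

lemma im_inv_ofReal_sub (w : ℂ) (E : ℝ) :
    (((E : ℂ) - w)⁻¹).im = w.im * ‖((E : ℂ) - w)⁻¹‖ ^ 2 := by
  rw [Complex.inv_im, norm_inv, inv_pow, ← Complex.normSq_eq_norm_sq]
  simp [div_eq_mul_inv]

section
variable (ν : Measure ℝ) [IsFiniteMeasure ν]

lemma integrable_inv_ofReal_sub {w : ℂ} (hw : w.im ≠ 0) :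
    Integrable (fun E : ℝ => ((E : ℂ) - w)⁻¹) ν :=
  Integrable.of_bound (continuous_inv_ofReal_sub hw).aestronglyMeasurable _
    (Filter.Eventually.of_forall (norm_inv_ofReal_sub_le hw))

lemma integrable_norm_mul_norm_inv {w w' : ℂ} (hw : w.im ≠ 0) (hw' : w'.im ≠ 0) :
    Integrable (fun E : ℝ => ‖((E : ℂ) - w)⁻¹‖ * ‖((E : ℂ) - w')⁻¹‖) ν := by
  refine Integrable.of_bound (C := |w.im|⁻¹ * |w'.im|⁻¹)
    ((continuous_inv_ofReal_sub hw).norm.mul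
      (continuous_inv_ofReal_sub hw').norm).aestronglyMeasurable
    (Filter.Eventually.of_forall fun E => ?_)
  rw [norm_mul, norm_norm, norm_norm]
  gcongr
  exacts [norm_inv_ofReal_sub_le hw E, norm_inv_ofReal_sub_le hw' E]

lemma im_integral_inv_ofReal_sub {w : ℂ} (hw : w.im ≠ 0) :
    (∫ E : ℝ, ((E : ℂ) - w)⁻¹ ∂ν).im = w.im * resolventSq ν w := by
  have h := integral_im (𝕜 := ℂ) (integrable_inv_ofReal_sub ν hw)
  simp only [RCLike.im_to_complex] at h
  rw [← h, resolventSq, ← integral_const_mul]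
  simp_rw [im_inv_ofReal_sub]

/-- Cauchy–Schwarz for two resolvent kernels. -/
lemma sq_integral_norm_mul_norm_le {w w' : ℂ} (hw : w.im ≠ 0) (hw' : w'.im ≠ 0) :
    (∫ E : ℝ, ‖((E : ℂ) - w)⁻¹‖ * ‖((E : ℂ) - w')⁻¹‖ ∂ν) ^ 2
      ≤ resolventSq ν w * resolventSq ν w' := by
  set K := ∫ E : ℝ, ‖((E : ℂ) - w)⁻¹‖ * ‖((E : ℂ) - w')⁻¹‖ ∂ν with hK
  have i1 := integrable_norm_mul_norm_inv ν hw hw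
  have i2 := integrable_norm_mul_norm_inv ν hw hw'
  have i3 := integrable_norm_mul_norm_inv ν hw' hw'
  have key : ∀ t : ℝ,
      0 ≤ resolventSq ν w * (t * t) + (-2 * K) * t + resolventSq ν w' := by
    intro t
    have h0 : 0 ≤ ∫ E : ℝ, (t * ‖((E : ℂ) - w)⁻¹‖ - ‖((E : ℂ) - w')⁻¹‖) ^ 2 ∂ν :=
      integral_nonneg fun _ => sq_nonneg _
    have h1 : ∫ E : ℝ, (t * ‖((E : ℂ) - w)⁻¹‖ - ‖((E : ℂ) - w')⁻¹‖) ^ 2 ∂ν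
        = ∫ E : ℝ, ((t * t) * (‖((E : ℂ) - w)⁻¹‖ * ‖((E : ℂ) - w)⁻¹‖)
          + (-2 * t) * (‖((E : ℂ) - w)⁻¹‖ * ‖((E : ℂ) - w')⁻¹‖)
          + ‖((E : ℂ) - w')⁻¹‖ * ‖((E : ℂ) - w')⁻¹‖) ∂ν := by
      congr 1 with E
      ring
    rw [h1, integral_add ((i1.const_mul _).fun_add (i2.const_mul _)) i3,
      integral_add (i1.const_mul _) (i2.const_mul _), integral_const_mul,
      integral_const_mul, ← hK] at h0
    simp only [resolventSq, pow_two]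
    linarith
  have := discrim_le_zero key
  rw [discrim] at this
  linarith

lemma sq_norm_integral_inv_sub_le {w w' : ℂ} (hw : w.im ≠ 0) (hw' : w'.im ≠ 0) :
    ‖(∫ E : ℝ, ((E : ℂ) - w)⁻¹ ∂ν) - ∫ E : ℝ, ((E : ℂ) - w')⁻¹ ∂ν‖ ^ 2
      ≤ ‖w - w'‖ ^ 2 * (resolventSq ν w * resolventSq ν w') := by
  rw [← integral_sub (integrable_inv_ofReal_sub ν hw) (integrable_inv_ofReal_sub ν hw')]
  calc _ ≤ (∫ E : ℝ, ‖((E : ℂ) - w)⁻¹ - ((E : ℂ) - w')⁻¹‖ ∂ν) ^ 2 := by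
        gcongr
        exact norm_integral_le_integral_norm _
    _ = (‖w - w'‖ * ∫ E : ℝ, ‖((E : ℂ) - w)⁻¹‖ * ‖((E : ℂ) - w')⁻¹‖ ∂ν) ^ 2 := by
        rw [← integral_const_mul]
        congr 2 with E
        rw [inv_sub_inv (ofReal_sub_ne_zero hw E) (ofReal_sub_ne_zero hw' E),
          sub_sub_sub_cancel_left, norm_div, norm_mul, norm_inv, norm_inv, div_eq_mul_inv, mul_inv]
    _ ≤ _ := by
        rw [mul_pow]
        gcongr
        exact sq_integral_norm_mul_norm_le ν hw hw'

end

/-- The spectral parameter `w` for which the system reads `f_α(z) = ∫ (E - w)⁻¹ dν₀(E)`. -/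
def scShift (s v : ℝ) (f : Fin 2 → ℂ → ℂ) (a : Fin 2) (z : ℂ) : ℂ :=
  z + (v : ℂ) ^ 2 * f (oppo a) z - (sgn a * s : ℝ)

lemma scShift_im (s v : ℝ) (f : Fin 2 → ℂ → ℂ) (a : Fin 2) (z : ℂ) :
    (scShift s v f a z).im = z.im + v ^ 2 * (f (oppo a) z).im := by
  rw [scShift, ← Complex.ofReal_pow, Complex.sub_im, Complex.add_im, Complex.im_ofReal_mul,
    Complex.ofReal_im, sub_zero]

lemma scShift_sub_scShift (s v : ℝ) (f g : Fin 2 → ℂ → ℂ) (a : Fin 2) (z : ℂ) :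
    scShift s v f a z - scShift s v g a z
      = (v : ℂ) ^ 2 * (f (oppo a) z - g (oppo a) z) := by
  rw [scShift, scShift]
  ring

namespace IsSCSolution

variable {ν0 : Measure ℝ} {s v : ℝ} {f g : Fin 2 → ℂ → ℂ} {z : ℂ}

lemma eq_integral (hf : IsSCSolution ν0 s v f) (a : Fin 2) (hz : z.im ≠ 0) :
    f a z = ∫ E : ℝ, ((E : ℂ) - scShift s v f a z)⁻¹ ∂ν0 := by
  rw [hf.2.2 a z hz]
  congr 1 with E
  rw [scShift]
  congr 1
  ring

lemma scShift_im_ne_zero (hf : IsSCSolution ν0 s v f) (a : Fin 2) (hz : z.im ≠ 0) :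
    (scShift s v f a z).im ≠ 0 := by
  intro h
  rw [scShift_im] at h
  have h1 := hf.2.1 (oppo a) z hz
  have h2 : 0 < z.im ^ 2 := by positivity
  have h3 : z.im ^ 2 + v ^ 2 * ((f (oppo a) z).im * z.im) = 0 := by linear_combination z.im * h
  nlinarith [mul_nonneg (sq_nonneg v) h1.le]

variable [IsFiniteMeasure ν0]

lemma im_mul_im (hf : IsSCSolution ν0 s v f) (a : Fin 2) (hz : z.im ≠ 0) :
    (f a z).im * z.im
      = (z.im ^ 2 + v ^ 2 * ((f (oppo a) z).im * z.im)) * resolventSq ν0 (scShift s v f a z) := by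
  have h := im_integral_inv_ofReal_sub ν0 (hf.scShift_im_ne_zero a hz)
  rw [← hf.eq_integral a hz, scShift_im] at h
  rw [h]
  ring

lemma resolventSq_mul_lt_one (hf : IsSCSolution ν0 s v f) (hz : z.im ≠ 0) :
    v ^ 4 * (resolventSq ν0 (scShift s v f 0 z) * resolventSq ν0 (scShift s v f 1 z)) < 1 := by
  have e0 := hf.im_mul_im 0 hz
  have e1 := hf.im_mul_im 1 hz
  have p0 := hf.2.1 0 z hz
  have p1 := hf.2.1 1 z hz
  simp only [oppo, if_true, one_ne_zero, if_false] at e0 e1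
  set x := (f 0 z).im * z.im
  set y := (f 1 z).im * z.im
  set A := resolventSq ν0 (scShift s v f 0 z)
  set B := resolventSq ν0 (scShift s v f 1 z)
  have h2 : 0 < z.im ^ 2 := by positivity
  have hP : 0 < (z.im ^ 2 + v ^ 2 * y) * (z.im ^ 2 + v ^ 2 * x) := by positivity
  have hAB : (z.im ^ 2 + v ^ 2 * y) * (z.im ^ 2 + v ^ 2 * x) * (A * B) = x * y := by
    linear_combination (-(z.im ^ 2 + v ^ 2 * x) * B) * e0 - x * e1
  have hlt : v ^ 4 * (x * y) < (z.im ^ 2 + v ^ 2 * y) * (z.im ^ 2 + v ^ 2 * x) := by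
    have q1 : 0 ≤ z.im ^ 2 * (v ^ 2 * x) := by positivity
    have q2 : 0 ≤ z.im ^ 2 * (v ^ 2 * y) := by positivity
    nlinarith [mul_pos h2 h2]
  refine lt_of_mul_lt_mul_left ?_ hP.le
  rw [mul_one]
  calc _ = v ^ 4 * (x * y) := by rw [← hAB]; ring
    _ < _ := hlt

lemma sq_norm_sub_le (hf : IsSCSolution ν0 s v f) (hg : IsSCSolution ν0 s v g) (a : Fin 2)
    (hz : z.im ≠ 0) :
    ‖f a z - g a z‖ ^ 2 ≤ v ^ 4 * (resolventSq ν0 (scShift s v f a z)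
      * resolventSq ν0 (scShift s v g a z)) * ‖f (oppo a) z - g (oppo a) z‖ ^ 2 := by
  have h := sq_norm_integral_inv_sub_le ν0 (hf.scShift_im_ne_zero a hz)
    (hg.scShift_im_ne_zero a hz)
  rw [← hf.eq_integral a hz, ← hg.eq_integral a hz, scShift_sub_scShift, norm_mul, norm_pow,
    Complex.norm_real, Real.norm_eq_abs, sq_abs] at h
  linarith

end IsSCSolution

/-- **Uniqueness for the self-consistent system.** -/
theorem sc_system_unique (ν0 : Measure ℝ) [IsProbabilityMeasure ν0]
    (s v : ℝ) (hs : 0 < s) (hv : 0 < v)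
    (f g : Fin 2 → ℂ → ℂ)
    (hf : IsSCSolution ν0 s v f) (hg : IsSCSolution ν0 s v g) :
    ∀ a : Fin 2, ∀ z : ℂ, z.im ≠ 0 → f a z = g a z := by
  intro a z hz
  have ha := hf.sq_norm_sub_le hg a hz
  have hb := hf.sq_norm_sub_le hg (oppo a) hz
  have hoo : oppo (oppo a) = a := by fin_cases a <;> rfl
  rw [hoo] at hb
  have hswap : ∀ h, IsSCSolution ν0 s v h → v ^ 4 * (resolventSq ν0 (scShift s v h a z)
      * resolventSq ν0 (scShift s v h (oppo a) z)) < 1 := by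
    intro h hh
    have := hh.resolventSq_mul_lt_one hz
    fin_cases a
    · exact this
    · rw [mul_comm (resolventSq _ _)] at this
      exact this
  have hF := hswap f hf
  have hG := hswap g hg
  have pf := resolventSq_nonneg ν0 (scShift s v f a z)
  have pf' := resolventSq_nonneg ν0 (scShift s v f (oppo a) z)
  have pg := resolventSq_nonneg ν0 (scShift s v g a z)
  have pg' := resolventSq_nonneg ν0 (scShift s v g (oppo a) z)
  set A := resolventSq ν0 (scShift s v f a z)
  set A' := resolventSq ν0 (scShift s v f (oppo a) z)
  set B := resolventSq ν0 (scShift s v g a z)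
  set B' := resolventSq ν0 (scShift s v g (oppo a) z)
  by_contra hne
  have hpos : 0 < ‖f a z - g a z‖ ^ 2 := by
    have := norm_pos_iff.mpr (sub_ne_zero.mpr hne)
    positivity
  have hle : ‖f a z - g a z‖ ^ 2
      ≤ (v ^ 4 * (A * A')) * (v ^ 4 * (B * B')) * ‖f a z - g a z‖ ^ 2 := by
    calc _ ≤ _ := ha
      _ ≤ v ^ 4 * (A * B) * (v ^ 4 * (A' * B') * ‖f a z - g a z‖ ^ 2) := by gcongr
      _ = _ := by ring
  have hlt : (v ^ 4 * (A * A')) * (v ^ 4 * (B * B')) < 1 :=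
    mul_lt_one_of_nonneg_of_lt_one_left (by positivity) hF hG.le
  exact absurd hle (not_le.mpr (mul_lt_of_lt_one_left hpos hlt))
end
end

section
/- Assume additionally that ν₀ is absolutely continuous with density ν₀' satisfying sup_{λ∈ℝ} ν₀'(λ) < ∞, and let (f_+, f_−) be a solution of the system in the stated class, with ν_α the probability measure such that f_α(z) = ∫ ν_α(dλ)/(λ−z). Then for α = ±: (a) Im f_α(z) ≤ π · sup_{μ∈ℝ} ν₀'(μ) for all Im z > 0; (b) ν_α(Δ) ≤ |Δ| · sup_{μ∈ℝ} ν₀'(μ) for every interval Δ ⊂ ℝ; in particular ν_α is absolutely continuous with density bounded by sup_{μ∈ℝ} ν₀'(μ). -/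
open MeasureTheory

noncomputable section

open ProbabilityTheory Filter Topology
open scoped ENNReal NNReal

/-- The imaginary part of a Stieltjes transform is `π` times a Cauchy average. -/
lemma ofReal_im_integral_inv_sub (μ : Measure ℝ) [IsFiniteMeasure μ] {w : ℂ} (hw : 0 < w.im) :
    ENNReal.ofReal (∫ E, ((E : ℂ) - w)⁻¹ ∂μ).im =
      ENNReal.ofReal Real.pi * ∫⁻ E, cauchyPDF w.re w.im.toNNReal E ∂μ := by
  have hint : Integrable (fun E : ℝ => ((E : ℂ) - w)⁻¹) μ := by
    refine Integrable.of_bound (C := w.im⁻¹) (by fun_prop) (.of_forall fun E => ?_)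
    rw [norm_inv]
    refine inv_anti₀ hw ?_
    simpa [abs_of_pos hw] using Complex.abs_im_le_norm ((E : ℂ) - w)
  have him (E : ℝ) : (((E : ℂ) - w)⁻¹).im =
      Real.pi * cauchyPDFReal w.re w.im.toNNReal E := by
    rw [cauchyPDFReal_def, Complex.inv_im, Complex.normSq_apply, Real.coe_toNNReal _ hw.le]
    simp only [Complex.sub_im, Complex.ofReal_im, Complex.sub_re, Complex.ofReal_re]
    have : 0 < (E - w.re) ^ 2 + w.im ^ 2 := by positivity
    have h2 : (E - w.re) * (E - w.re) + (0 - w.im) * (0 - w.im) =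
      (E - w.re) ^ 2 + w.im ^ 2 := by ring
    rw [h2]
    field_simp
    ring
  have hpos (E : ℝ) : 0 ≤ (((E : ℂ) - w)⁻¹).im := by
    rw [him]
    exact mul_nonneg Real.pi_pos.le (cauchyPDF_pos _ (by simpa using hw) _).le
  have him_int : (∫ E, ((E : ℂ) - w)⁻¹ ∂μ).im = ∫ E, (((E : ℂ) - w)⁻¹).im ∂μ :=
    (Complex.imCLM.integral_comp_comm hint).symm
  have him_integrable : Integrable (fun E : ℝ => (((E : ℂ) - w)⁻¹).im) μ :=
    Complex.imCLM.integrable_comp hint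
  rw [him_int, ofReal_integral_eq_lintegral_ofReal him_integrable (.of_forall hpos),
    ← lintegral_const_mul _ (measurable_cauchyPDF _ _)]
  refine lintegral_congr fun E => ?_
  rw [him, cauchyPDF_def, ENNReal.ofReal_mul Real.pi_pos.le]

/-- A measure dominated by `C • volume` has Cauchy averages at most `C`. -/
lemma lintegral_cauchyPDF_le {μ : Measure ℝ} {C : ℝ≥0} (hμ : μ ≤ C • volume) (x : ℝ) {γ : ℝ≥0}
    (hγ : γ ≠ 0) : ∫⁻ E, cauchyPDF x γ E ∂μ ≤ C := by
  calc ∫⁻ E, cauchyPDF x γ E ∂μ ≤ ∫⁻ E, cauchyPDF x γ E ∂(C • volume) := lintegral_mono' hμ le_rfl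
    _ = C := by
      rw [lintegral_smul_measure, lintegral_cauchyPDF_eq_one x hγ]
      simp [ENNReal.smul_def]

/-- The mass a Cauchy density puts within distance `δ` of its centre. -/
lemma setLIntegral_cauchyPDF_Icc (x : ℝ) {γ : ℝ≥0} (hγ : γ ≠ 0) {δ : ℝ} (hδ : 0 ≤ δ) :
    ∫⁻ t in Set.Icc (x - δ) (x + δ), cauchyPDF x γ t =
      ENNReal.ofReal (2 * Real.pi⁻¹ * Real.arctan (δ / γ)) := by
  have hγ' : (γ : ℝ) ≠ 0 := by exact_mod_cast hγ
  simp only [cauchyPDF_def]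
  rw [← ofReal_integral_eq_lintegral_ofReal (integrable_cauchyPDFReal x).integrableOn
    (.of_forall fun t => (cauchyPDF_pos _ hγ _).le), integral_Icc_eq_integral_Ioc,
    ← intervalIntegral.integral_of_le (by linarith)]
  congr 1
  rw [intervalIntegral.integral_eq_sub_of_hasDerivAt
    (f := fun t => Real.pi⁻¹ * Real.arctan ((t - x) / γ))]
  · simp only [add_sub_cancel_left, sub_sub_cancel_left, neg_div, Real.arctan_neg]
    ring
  · intro t _
    have h := ((((hasDerivAt_id t).sub_const x).div_const (γ : ℝ)).arctan).const_mul Real.pi⁻¹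
    refine h.congr_deriv ?_
    rw [cauchyPDFReal_def']
    simp
    ring
  · exact (integrable_cauchyPDFReal x).intervalIntegrable

lemma cauchyPDF_comm (x t : ℝ) (γ : ℝ≥0) : cauchyPDF x γ t = cauchyPDF t γ x := by
  rw [cauchyPDF_def, cauchyPDF_def, cauchyPDFReal_def, cauchyPDFReal_def, ← neg_sub x t, neg_sq]

/-- Stieltjes inversion, as an inequality: bounded Cauchy averages bound the mass of intervals. -/
lemma measureReal_Icc_le_of_lintegral_cauchyPDF_le {ν : Measure ℝ} [IsFiniteMeasure ν] {C : ℝ≥0}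
    (h : ∀ (t : ℝ) (γ : ℝ≥0), γ ≠ 0 → ∫⁻ l, cauchyPDF t γ l ∂ν ≤ C) {x y : ℝ} (hxy : x ≤ y) :
    ν.real (Set.Icc x y) ≤ (y - x) * C := by
  have key : ∀ δ : ℝ, 0 < δ →
      ν.real (Set.Icc x y) * (2 * Real.pi⁻¹ * Real.arctan δ⁻¹) ≤ (y - x + 2 * δ) * C := by
    intro δ hδ
    set γ : ℝ≥0 := (δ ^ 2).toNNReal with hγdef
    have hγ : γ ≠ 0 := by simpa [hγdef] using hδ.ne'
    have hγ' : (γ : ℝ) = δ ^ 2 := Real.coe_toNNReal _ (by positivity)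
    have hmeas : Measurable (fun p : ℝ × ℝ => cauchyPDF p.1 γ p.2) := by
      simp only [cauchyPDF_def, cauchyPDFReal_def]
      fun_prop
    have hE : ν (Set.Icc x y) * ENNReal.ofReal (2 * Real.pi⁻¹ * Real.arctan δ⁻¹) ≤
        ENNReal.ofReal (y - x + 2 * δ) * C := by
      calc ν (Set.Icc x y) * ENNReal.ofReal (2 * Real.pi⁻¹ * Real.arctan δ⁻¹)
          = ∫⁻ l in Set.Icc x y, (∫⁻ t in Set.Icc (l - δ) (l + δ), cauchyPDF t γ l) ∂ν := by
            rw [mul_comm, ← setLIntegral_const]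
            refine lintegral_congr fun l => ?_
            simp_rw [cauchyPDF_comm _ l]
            rw [setLIntegral_cauchyPDF_Icc l hγ hδ.le, hγ']
            congr 4
            field_simp
        _ ≤ ∫⁻ l in Set.Icc x y, (∫⁻ t in Set.Icc (x - δ) (y + δ), cauchyPDF t γ l) ∂ν := by
            refine setLIntegral_mono' measurableSet_Icc fun l hl => ?_
            exact lintegral_mono_set
              (Set.Icc_subset_Icc (by linarith [hl.1]) (by linarith [hl.2]))
        _ ≤ ∫⁻ l, (∫⁻ t in Set.Icc (x - δ) (y + δ), cauchyPDF t γ l) ∂ν :=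
            setLIntegral_le_lintegral _ _
        _ = ∫⁻ t in Set.Icc (x - δ) (y + δ), ∫⁻ l, cauchyPDF t γ l ∂ν :=
            lintegral_lintegral_swap (hmeas.comp measurable_swap).aemeasurable
        _ ≤ ∫⁻ t in Set.Icc (x - δ) (y + δ), (C : ℝ≥0∞) := lintegral_mono fun t => h t γ hγ
        _ = ENNReal.ofReal (y - x + 2 * δ) * C := by
            rw [setLIntegral_const, Real.volume_Icc, mul_comm]
            congr 2
            ring
    have hR := ENNReal.toReal_mono (by finiteness) hE
    have hat : 0 ≤ Real.arctan δ⁻¹ := Real.arctan_nonneg.2 (by positivity)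
    rwa [ENNReal.toReal_mul, ENNReal.toReal_mul, ENNReal.toReal_ofReal (by positivity),
      ENNReal.toReal_ofReal (by linarith), ENNReal.coe_toReal] at hR
  have hl : Tendsto (fun δ : ℝ => ν.real (Set.Icc x y) * (2 * Real.pi⁻¹ * Real.arctan δ⁻¹))
      (𝓝[>] 0) (𝓝 (ν.real (Set.Icc x y) * (2 * Real.pi⁻¹ * (Real.pi / 2)))) :=
    (((tendsto_nhds_of_tendsto_nhdsWithin Real.tendsto_arctan_atTop).comp
      tendsto_inv_nhdsGT_zero).const_mul _).const_mul _
  have hr : Tendsto (fun δ : ℝ => (y - x + 2 * δ) * C) (𝓝[>] 0) (𝓝 ((y - x + 2 * 0) * C)) :=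
    tendsto_nhdsWithin_of_tendsto_nhds (Continuous.tendsto (by fun_prop) 0)
  have := le_of_tendsto_of_tendsto hl hr
    (eventually_nhdsWithin_of_forall fun δ hδ => key δ hδ)
  have hpi : 2 * Real.pi⁻¹ * (Real.pi / 2) = 1 := by field_simp
  simpa [hpi] using this

/-- A probability measure with interval masses at most `C` times the length is dominated by
`C • volume`. -/
lemma le_smul_volume_of_measureReal_Icc_le {ν : Measure ℝ} [IsProbabilityMeasure ν] {C : ℝ≥0}
    (h : ∀ x y : ℝ, x ≤ y → ν.real (Set.Icc x y) ≤ (y - x) * C) : ν ≤ C • volume := by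
  let G : StieltjesFunction ℝ :=
    { toFun := fun x => C * x - cdf ν x
      mono' := fun x y hxy => by
        have h1 : ν.real (Set.Iic y) ≤ ν.real (Set.Iic x) + ν.real (Set.Icc x y) := by
          refine (measureReal_mono fun t ht => ?_).trans (measureReal_union_le _ _)
          rcases le_total t x with htx | htx
          exacts [.inl htx, .inr ⟨htx, ht⟩]
        have h2 := h x y hxy
        rw [← cdf_eq_real, ← cdf_eq_real] at h1
        simp only
        linarith
      right_continuous' := fun x =>
        (Continuous.continuousWithinAt (by fun_prop)).sub ((cdf ν).right_continuous x) }
  have hG : C • StieltjesFunction.id = cdf ν + G := by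
    ext x
    change (C : ℝ) * x = cdf ν x + (C * x - cdf ν x)
    ring
  rw [Real.volume_eq_stieltjes_id, ← StieltjesFunction.measure_smul, hG,
    StieltjesFunction.measure_add, measure_cdf]
  exact Measure.le_add_right le_rfl

/-- A finite measure dominated by `C • volume` has a density with values in `[0, C]`. -/
lemma exists_density_of_le_smul_volume {ν : Measure ℝ} [IsFiniteMeasure ν] {C : ℝ≥0}
    (h : ν ≤ C • volume) : ∃ g : ℝ → ℝ, (∀ x, 0 ≤ g x ∧ g x ≤ C) ∧
      ν = volume.withDensity (fun x => ENNReal.ofReal (g x)) := by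
  have hac : ν ≪ volume := (Measure.absolutelyContinuous_of_le h).trans
    (Measure.AbsolutelyContinuous.rfl.smul_left C)
  have hle : ν.rnDeriv volume ≤ᵐ[volume] fun _ => (C : ℝ≥0∞) := by
    refine ae_le_of_forall_setLIntegral_le_of_sigmaFinite (Measure.measurable_rnDeriv _ _)
      fun s _ _ => ?_
    rw [setLIntegral_const]
    simpa only [Measure.smul_apply, ENNReal.smul_def, smul_eq_mul] using (Measure.setLIntegral_rnDeriv_le s).trans (h s)
  refine ⟨fun x => min (ν.rnDeriv volume x).toReal C,
    fun x => ⟨le_min ENNReal.toReal_nonneg C.2, min_le_right _ _⟩, ?_⟩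
  rw [← Measure.withDensity_rnDeriv_eq ν volume hac]
  refine withDensity_congr_ae ?_
  rw [Measure.withDensity_rnDeriv_eq ν volume hac]
  filter_upwards [hle] with x hx
  have hfin : ν.rnDeriv volume x ≠ ∞ := ne_top_of_le_ne_top ENNReal.coe_ne_top hx
  rw [min_eq_left (by simpa using ENNReal.toReal_mono ENNReal.coe_ne_top hx),
    ENNReal.ofReal_toReal hfin]

/-- A measure with a density bounded by `C` is dominated by `C • volume`. No measurability of the
density is needed. -/
lemma withDensity_le_smul_volume {g : ℝ → ℝ} {C : ℝ≥0} (hg : ∀ x, g x ≤ C) :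
    volume.withDensity (fun x => ENNReal.ofReal (g x)) ≤ C • volume := by
  refine Measure.le_iff.2 fun s hs => ?_
  rw [withDensity_apply _ hs]
  calc ∫⁻ x in s, ENNReal.ofReal (g x) ≤ ∫⁻ _ in s, (C : ℝ≥0∞) :=
        lintegral_mono fun x => by simpa using ENNReal.ofReal_le_ofReal (hg x)
    _ = (C • volume) s := by
        rw [setLIntegral_const, Measure.smul_apply, ENNReal.smul_def, smul_eq_mul]

/-- If `ν₀` has a bounded density then so do the measures `ν_α` associated with the solution
of the self-consistent system, with the same bound. -/
theorem sc_solution_bounded_density (ν0 : Measure ℝ) [IsProbabilityMeasure ν0]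
    (s v : ℝ) (hs : 0 < s) (hv : 0 < v)
    (ν0' : ℝ → ℝ) (hnn : ∀ x, 0 ≤ ν0' x)
    (hdens : ν0 = MeasureTheory.volume.withDensity (fun x => ENNReal.ofReal (ν0' x)))
    (hbdd : BddAbove (Set.range ν0'))
    (f : Fin 2 → ℂ → ℂ) (hf : IsSCSolution ν0 s v f)
    (ν : Fin 2 → Measure ℝ) (hνp : ∀ a, IsProbabilityMeasure (ν a))
    (hst : ∀ a : Fin 2, ∀ z : ℂ, z.im ≠ 0 → f a z = ∫ lam, ((lam : ℂ) - z)⁻¹ ∂(ν a)) :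
    ∀ a : Fin 2,
      (∀ z : ℂ, 0 < z.im → (f a z).im ≤ Real.pi * ⨆ μ, ν0' μ) ∧
      (∀ x y : ℝ, x ≤ y → (ν a (Set.Icc x y)).toReal ≤ (y - x) * ⨆ μ, ν0' μ) ∧
      ∃ g : Fin 2 → ℝ → ℝ, (∀ x, 0 ≤ g a x ∧ g a x ≤ ⨆ μ, ν0' μ) ∧
        ν a = MeasureTheory.volume.withDensity (fun x => ENNReal.ofReal (g a x)) := by
  obtain ⟨C, hC⟩ : ∃ C : ℝ≥0, (C : ℝ) = ⨆ μ, ν0' μ := ⟨⟨_, Real.iSup_nonneg hnn⟩, rfl⟩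
  have hν0 : ν0 ≤ C • volume := by
    rw [hdens]
    exact withDensity_le_smul_volume fun x => hC ▸ le_ciSup hbdd x
  rw [← hC]
  obtain ⟨-, hpos, heq⟩ := hf
  have hupper (a : Fin 2) (z : ℂ) (hz : 0 < z.im) :
      ENNReal.ofReal (f a z).im ≤ ENNReal.ofReal Real.pi * C := by
    let w : ℂ := z + (v : ℂ) ^ 2 * f (oppo a) z - (sgn a * s : ℝ)
    have hw : 0 < w.im := by
      have hfim : 0 < (f (oppo a) z).im := pos_of_mul_pos_left (hpos (oppo a) z hz.ne') hz.le
      have him : w.im = z.im + v ^ 2 * (f (oppo a) z).im := by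
        simp [w, ← Complex.ofReal_pow]
      rw [him]
      positivity
    have hfw : f a z = ∫ E, ((E : ℂ) - w)⁻¹ ∂ν0 := by
      rw [heq a z hz.ne']
      congr with E
      congr 1
      simp only [w]
      ring
    rw [hfw, ofReal_im_integral_inv_sub ν0 hw]
    gcongr
    exact lintegral_cauchyPDF_le hν0 _ (by simpa using hw)
  intro a
  have := hνp a
  have hcauchy (t : ℝ) (γ : ℝ≥0) (hγ : γ ≠ 0) : ∫⁻ l, cauchyPDF t γ l ∂(ν a) ≤ C := by
    have hz : 0 < (⟨t, γ⟩ : ℂ).im := NNReal.coe_pos.2 (pos_iff_ne_zero.2 hγ)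
    have h := hupper a ⟨t, γ⟩ hz
    rw [hst a _ hz.ne', ofReal_im_integral_inv_sub (ν a) hz, Real.toNNReal_coe] at h
    exact (ENNReal.mul_le_mul_iff_right (by simp [Real.pi_pos]) (by simp)).1 h
  have hIcc (x y : ℝ) (hxy : x ≤ y) : (ν a).real (Set.Icc x y) ≤ (y - x) * C :=
    measureReal_Icc_le_of_lintegral_cauchyPDF_le hcauchy hxy
  refine ⟨fun z hz => ?_, hIcc, ?_⟩
  · have h := hupper a z hz
    rw [← ENNReal.ofReal_coe_nnreal, ← ENNReal.ofReal_mul Real.pi_pos.le] at h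
    exact (ENNReal.ofReal_le_ofReal_iff (by positivity)).1 h
  · obtain ⟨g, hg, hνg⟩ :=
      exists_density_of_le_smul_volume (le_smul_volume_of_measureReal_Icc_le hIcc)
    exact ⟨fun _ => g, hg, hνg⟩
end
end

section
/- Let z ∈ ℂ with Im z ≠ 0, let E, s ∈ ℝ, v ∈ ℝ, and let f be a 2×2 complex matrix such that Im z · Im(fξ, ξ) ≥ 0 for every ξ ∈ ℂ². Then the 2×2 matrix M = (E − z)·1₂ + s σ^z − v² σ^x f σ^x is invertible and ‖M^{−1}‖ ≤ |Im z|^{−1}, where ‖·‖ is the operator norm. -/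
open Matrix

noncomputable section

def sigmaX : Matrix (Fin 2) (Fin 2) ℂ := !![0, 1; 1, 0]
def sigmaZ : Matrix (Fin 2) (Fin 2) ℂ := !![1, 0; 0, -1]

/-- Cauchy–Schwarz for the standard Hermitian form on `ι → ℂ`. -/
theorem norm_sum_mul_conj_le_sqrt_mul_sqrt {ι : Type*} [Fintype ι] (x y : ι → ℂ) :
    ‖∑ i, x i * starRingEnd ℂ (y i)‖ ≤
      Real.sqrt (∑ i, ‖x i‖ ^ 2) * Real.sqrt (∑ i, ‖y i‖ ^ 2) := by
  have h := norm_inner_le_norm (𝕜 := ℂ) (WithLp.toLp 2 y) (WithLp.toLp 2 x)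
  simpa [PiLp.inner_apply, EuclideanSpace.norm_eq, mul_comm] using h

/-- A matrix whose numerical range is bounded away from zero is bounded below. -/
theorem mul_sqrt_le_sqrt_mulVec_of_le_norm_form {ι : Type*} [Fintype ι] {c : ℝ}
    {M : Matrix ι ι ℂ}
    (hM : ∀ ξ : ι → ℂ, c * ∑ i, ‖ξ i‖ ^ 2 ≤ ‖∑ i, (M *ᵥ ξ) i * starRingEnd ℂ (ξ i)‖)
    (ξ : ι → ℂ) :
    c * Real.sqrt (∑ i, ‖ξ i‖ ^ 2) ≤ Real.sqrt (∑ i, ‖(M *ᵥ ξ) i‖ ^ 2) := by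
  have hS : 0 ≤ ∑ i, ‖ξ i‖ ^ 2 := Finset.sum_nonneg fun i _ => sq_nonneg _
  rcases (Real.sqrt_nonneg (∑ i, ‖ξ i‖ ^ 2)).eq_or_lt with h0 | hpos
  · rw [← h0, mul_zero]
    exact Real.sqrt_nonneg _
  · refine le_of_mul_le_mul_right ?_ hpos
    rw [mul_assoc, Real.mul_self_sqrt hS]
    exact (hM ξ).trans (norm_sum_mul_conj_le_sqrt_mul_sqrt _ _)

theorem isUnit_of_le_norm_form {ι : Type*} [Fintype ι] [DecidableEq ι] {c : ℝ} (hc : 0 < c)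
    {M : Matrix ι ι ℂ}
    (hM : ∀ ξ : ι → ℂ, c * ∑ i, ‖ξ i‖ ^ 2 ≤ ‖∑ i, (M *ᵥ ξ) i * starRingEnd ℂ (ξ i)‖) :
    IsUnit M := by
  rw [← Matrix.mulVec_injective_iff_isUnit]
  refine (injective_iff_map_eq_zero M.mulVecLin).2 fun ξ hξ => ?_
  have h := hM ξ
  rw [Matrix.mulVecLin_apply] at hξ
  simp only [hξ, Pi.zero_apply, zero_mul, Finset.sum_const_zero, norm_zero] at h
  have hS : ∑ i, ‖ξ i‖ ^ 2 = 0 :=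
    le_antisymm (nonpos_of_mul_nonpos_right h hc) (Finset.sum_nonneg fun i _ => sq_nonneg _)
  funext i
  simpa using (Finset.sum_eq_zero_iff_of_nonneg fun i _ => sq_nonneg _).1 hS i (Finset.mem_univ i)

theorem sqrt_inv_mulVec_le_of_le_norm_form {ι : Type*} [Fintype ι] [DecidableEq ι] {c : ℝ}
    (hc : 0 < c) {M : Matrix ι ι ℂ}
    (hM : ∀ ξ : ι → ℂ, c * ∑ i, ‖ξ i‖ ^ 2 ≤ ‖∑ i, (M *ᵥ ξ) i * starRingEnd ℂ (ξ i)‖)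
    (ξ : ι → ℂ) :
    Real.sqrt (∑ i, ‖(M⁻¹ *ᵥ ξ) i‖ ^ 2) ≤ c⁻¹ * Real.sqrt (∑ i, ‖ξ i‖ ^ 2) := by
  have hdet := (Matrix.isUnit_iff_isUnit_det M).1 (isUnit_of_le_norm_form hc hM)
  have h := mul_sqrt_le_sqrt_mulVec_of_le_norm_form hM (M⁻¹ *ᵥ ξ)
  rw [Matrix.mulVec_mulVec, Matrix.mul_nonsing_inv _ hdet, Matrix.one_mulVec] at h
  exact (le_inv_mul_iff₀ hc).2 h

/-- The real diagonal part of `M` does not contribute to `Im (Mξ, ξ)`. -/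
theorem im_form_eq (z : ℂ) (E s v : ℝ) (f : Matrix (Fin 2) (Fin 2) ℂ) (ξ : Fin 2 → ℂ) :
    (∑ i, ((((E : ℂ) - z) • (1 : Matrix (Fin 2) (Fin 2) ℂ) + (s : ℂ) • sigmaZ
        - ((v : ℂ) ^ 2) • (sigmaX * f * sigmaX)) *ᵥ ξ) i * starRingEnd ℂ (ξ i)).im =
      -(z.im * ∑ i, ‖ξ i‖ ^ 2) -
        v ^ 2 * (∑ i, (f *ᵥ (sigmaX *ᵥ ξ)) i * starRingEnd ℂ ((sigmaX *ᵥ ξ) i)).im := by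
  have hconj : sigmaX * f * sigmaX = !![f 1 1, f 1 0; f 0 1, f 0 0] := by
    ext i j
    fin_cases i <;> fin_cases j <;>
      simp [sigmaX, Matrix.vecMul, dotProduct, Matrix.mul_apply, Fin.sum_univ_two]
  rw [hconj, ← Complex.ofReal_pow]
  simp [-Complex.ofReal_pow, Fin.sum_univ_two, sigmaX, sigmaZ, Matrix.mulVec, dotProduct,
    Complex.sq_norm, Complex.normSq_apply]
  ring

theorem abs_im_mul_le_norm_form (z : ℂ) (hz : z.im ≠ 0) (E s v : ℝ)
    (f : Matrix (Fin 2) (Fin 2) ℂ)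
    (hf : ∀ ξ : Fin 2 → ℂ,
      0 ≤ z.im * (∑ i, (f *ᵥ ξ) i * starRingEnd ℂ (ξ i)).im) (ξ : Fin 2 → ℂ) :
    |z.im| * ∑ i, ‖ξ i‖ ^ 2 ≤
      ‖∑ i, ((((E : ℂ) - z) • (1 : Matrix (Fin 2) (Fin 2) ℂ) + (s : ℂ) • sigmaZ
        - ((v : ℂ) ^ 2) • (sigmaX * f * sigmaX)) *ᵥ ξ) i * starRingEnd ℂ (ξ i)‖ := by
  refine le_trans ?_ (Complex.abs_im_le_norm _)
  refine le_of_mul_le_mul_left ?_ (abs_pos.2 hz)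
  rw [im_form_eq, ← abs_mul, ← mul_assoc, abs_mul_abs_self]
  refine le_trans ?_ (neg_le_abs _)
  linarith [mul_nonneg (sq_nonneg v) (hf (sigmaX *ᵥ ξ))]

/-- If `Im z ≠ 0` and `Im z · Im(fξ, ξ) ≥ 0` for all `ξ ∈ ℂ²`, then
`M = (E − z)1₂ + sσᶻ − v²σˣfσˣ` is invertible with `‖M⁻¹‖ ≤ |Im z|⁻¹`
(operator norm with respect to the Euclidean norm on `ℂ²`). -/
theorem inverse_bound_dissipative_matrix
    (z : ℂ) (hz : z.im ≠ 0) (E s v : ℝ) (f : Matrix (Fin 2) (Fin 2) ℂ)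
    (hf : ∀ ξ : Fin 2 → ℂ,
      0 ≤ z.im * (∑ i, (f *ᵥ ξ) i * starRingEnd ℂ (ξ i)).im) :
    IsUnit (((E : ℂ) - z) • (1 : Matrix (Fin 2) (Fin 2) ℂ) + (s : ℂ) • sigmaZ
        - ((v : ℂ) ^ 2) • (sigmaX * f * sigmaX)) ∧
      ∀ ξ : Fin 2 → ℂ,
        Real.sqrt (∑ i, ‖((((E : ℂ) - z) • (1 : Matrix (Fin 2) (Fin 2) ℂ) + (s : ℂ) • sigmaZ
            - ((v : ℂ) ^ 2) • (sigmaX * f * sigmaX))⁻¹ *ᵥ ξ) i‖ ^ 2) ≤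
          |z.im|⁻¹ * Real.sqrt (∑ i, ‖ξ i‖ ^ 2) := by
  have hM := abs_im_mul_le_norm_form z hz E s v f hf
  exact ⟨isUnit_of_le_norm_form (abs_pos.2 hz) hM,
    sqrt_inv_mulVec_le_of_le_norm_form (abs_pos.2 hz) hM⟩
end
end
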